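/- Let W be a discrete memoryless channel with finite input alphabet X and finite output alphabet Y, and let ε ∈ (0,1) be such that the ε-channel dispersion V_ε of W equals zero. Assume further that it is not the case that W is exotic and ε ≥ 1/2. Then there exists a constant K ∈ ℝ such that for all n ≥ 1, log M*(W^n, ε) ≤ n·C + K, where C is the capacity of W. -/

import Mathlib

open Finset MeasureTheory

/-- `P` is a probability distribution on the finite set `Z`. -/
def IsDist {Z : Type*} [Fintype Z] (P : Z → ℝ) : Prop :=
  (∀ z, 0 ≤ P z) ∧ ∑ z, P z = 1

/-- `W` is a (discrete memoryless) channel from `X` to `Y`: a stochastic matrix. -/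
def IsChannel {X Y : Type*} [Fintype X] [Fintype Y] (W : X → Y → ℝ) : Prop :=
  ∀ x, IsDist (W x)

/-- Relative entropy `D(P‖Q) = Σ_z P(z) log (P(z)/Q(z))`. -/
noncomputable def relEnt {Z : Type*} [Fintype Z] (P Q : Z → ℝ) : ℝ :=
  ∑ z, P z * Real.log (P z / Q z)

/-- Divergence variance `V(P‖Q)`. -/
noncomputable def divVar {Z : Type*} [Fintype Z] (P Q : Z → ℝ) : ℝ :=
  ∑ z, P z * (Real.log (P z / Q z) - relEnt P Q) ^ 2

/-- Output distribution `PW`. -/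
noncomputable def outDist {X Y : Type*} [Fintype X] (P : X → ℝ) (W : X → Y → ℝ) (y : Y) : ℝ :=
  ∑ x, P x * W x y

/-- Mutual information `I(P,W) = Σ_x P(x) D(W(·|x)‖PW)`. -/
noncomputable def mutInfo {X Y : Type*} [Fintype X] [Fintype Y] (P : X → ℝ) (W : X → Y → ℝ) : ℝ :=
  ∑ x, P x * relEnt (W x) (outDist P W)

/-- Channel capacity `C = max_P I(P,W)`. -/
noncomputable def capacity {X Y : Type*} [Fintype X] [Fintype Y] (W : X → Y → ℝ) : ℝ :=
  sSup {c : ℝ | ∃ P : X → ℝ, IsDist P ∧ c = mutInfo P W}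

/-- `P` is a capacity-achieving input distribution (member of `Π`). -/
def isCAID {X Y : Type*} [Fintype X] [Fintype Y] (W : X → Y → ℝ) (P : X → ℝ) : Prop :=
  IsDist P ∧ mutInfo P W = capacity W

/-- Conditional information variance `V(P,W) = Σ_x P(x) V(W(·|x)‖PW)`. -/
noncomputable def infoVar {X Y : Type*} [Fintype X] [Fintype Y] (P : X → ℝ) (W : X → Y → ℝ) : ℝ :=
  ∑ x, P x * divVar (W x) (outDist P W)

/-- `V_min = min_{P ∈ Π} V(P,W)`. -/
noncomputable def Vmin {X Y : Type*} [Fintype X] [Fintype Y] (W : X → Y → ℝ) : ℝ :=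
  sInf {v : ℝ | ∃ P : X → ℝ, isCAID W P ∧ v = infoVar P W}

/-- `V_max = max_{P ∈ Π} V(P,W)`. -/
noncomputable def Vmax {X Y : Type*} [Fintype X] [Fintype Y] (W : X → Y → ℝ) : ℝ :=
  sSup {v : ℝ | ∃ P : X → ℝ, isCAID W P ∧ v = infoVar P W}

/-- The `ε`-channel dispersion `V_ε`. -/
noncomputable def Veps {X Y : Type*} [Fintype X] [Fintype Y] (W : X → Y → ℝ) (ε : ℝ) : ℝ :=
  if ε < 1/2 then Vmin W else Vmax W

/-- Average error probability of the code `(e, d)` with `M` messages for channel `V`. -/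
noncomputable def avgErr {A B : Type*} [Fintype B] {M : ℕ} (V : A → B → ℝ)
    (e : Fin M → A) (d : B → Fin M) : ℝ :=
  1 - (1 / (M : ℝ)) * ∑ m : Fin M, ∑ b ∈ Finset.univ.filter (fun b => d b = m), V (e m) b

/-- `M*(V,ε)`: the largest number of messages of a code with average error probability `≤ ε`. -/
noncomputable def Mstar {A B : Type*} [Fintype B] (V : A → B → ℝ) (ε : ℝ) : ℕ :=
  sSup {M : ℕ | ∃ e : Fin M → A, ∃ d : B → Fin M, avgErr V e d ≤ ε}

/-- `W` is exotic: `V_max = 0` and there is a symbol `x₀` with `D(W(·|x₀)‖Q*) = C` and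
`V(W(·|x₀)‖Q*) > 0`, where `Q* = PW` for any capacity-achieving input distribution `P`. -/
def IsExotic {X Y : Type*} [Fintype X] [Fintype Y] (W : X → Y → ℝ) : Prop :=
  Vmax W = 0 ∧ ∃ x₀ : X, ∀ P : X → ℝ, isCAID W P →
    relEnt (W x₀) (outDist P W) = capacity W ∧ 0 < divVar (W x₀) (outDist P W)

/-! ### Relative entropy and capacity-achieving distributions -/

lemma relEnt_eq_sum_klFun {Z : Type*} [Fintype Z] {P Q : Z → ℝ} (hP : IsDist P) (hQ : IsDist Q)
    (hPQ : ∀ z, Q z = 0 → P z = 0) :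
    relEnt P Q = ∑ z, Q z * InformationTheory.klFun (P z / Q z) := by
  have h : ∀ z, Q z * InformationTheory.klFun (P z / Q z) =
      P z * Real.log (P z / Q z) + Q z - P z := by
    intro z
    by_cases hz : Q z = 0
    · simp [hz, hPQ z hz]
    · rw [InformationTheory.klFun_apply]
      field_simp
  simp_rw [h, Finset.sum_sub_distrib, Finset.sum_add_distrib, hP.2, hQ.2]
  simp [relEnt]

lemma relEnt_nonneg {Z : Type*} [Fintype Z] {P Q : Z → ℝ} (hP : IsDist P) (hQ : IsDist Q)
    (hPQ : ∀ z, Q z = 0 → P z = 0) : 0 ≤ relEnt P Q := by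
  rw [relEnt_eq_sum_klFun hP hQ hPQ]
  exact Finset.sum_nonneg fun z _ =>
    mul_nonneg (hQ.1 z) (InformationTheory.klFun_nonneg (div_nonneg (hP.1 z) (hQ.1 z)))

lemma eq_of_relEnt_nonpos {Z : Type*} [Fintype Z] {P Q : Z → ℝ} (hP : IsDist P) (hQ : IsDist Q)
    (hPQ : ∀ z, Q z = 0 → P z = 0) (h : relEnt P Q ≤ 0) : P = Q := by
  have h0 := le_antisymm h (relEnt_nonneg hP hQ hPQ)
  rw [relEnt_eq_sum_klFun hP hQ hPQ, Finset.sum_eq_zero_iff_of_nonneg fun z _ =>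
    mul_nonneg (hQ.1 z) (InformationTheory.klFun_nonneg (div_nonneg (hP.1 z) (hQ.1 z)))] at h0
  funext z
  by_cases hz : Q z = 0
  · rw [hz, hPQ z hz]
  · have h1 := (mul_eq_zero.1 (h0 z (Finset.mem_univ z))).resolve_left hz
    rw [InformationTheory.klFun_eq_zero_iff (div_nonneg (hP.1 z) (hQ.1 z))] at h1
    field_simp at h1
    exact h1

section Capacity

variable {X Y : Type*} [Fintype X] [Fintype Y] {W : X → Y → ℝ} {P : X → ℝ}

lemma isDist_outDist (hW : IsChannel W) (hP : IsDist P) : IsDist (outDist P W) := by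
  refine ⟨fun y => Finset.sum_nonneg fun x _ => mul_nonneg (hP.1 x) ((hW x).1 y), ?_⟩
  unfold outDist
  rw [Finset.sum_comm]
  simp_rw [← Finset.mul_sum, (hW _).2, mul_one, hP.2]

lemma mul_eq_zero_of_outDist_eq_zero (hW : IsChannel W) (hP : ∀ x, 0 ≤ P x) {y : Y}
    (h : outDist P W y = 0) (x : X) : P x * W x y = 0 :=
  (Finset.sum_eq_zero_iff_of_nonneg fun x _ => mul_nonneg (hP x) ((hW x).1 y)).1 h x
    (Finset.mem_univ x)

lemma mutInfo_eq (hW : IsChannel W) (hP : ∀ x, 0 ≤ P x) :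
    mutInfo P W = ∑ x, P x * ∑ y, W x y * Real.log (W x y) +
      ∑ y, Real.negMulLog (outDist P W y) := by
  have h : ∀ x y, P x * (W x y * Real.log (W x y / outDist P W y)) =
      P x * (W x y * Real.log (W x y)) - P x * W x y * Real.log (outDist P W y) := by
    intro x y
    by_cases h0 : P x * W x y = 0
    · rcases mul_eq_zero.1 h0 with h1 | h1 <;> simp [h1]
    · rw [Real.log_div (right_ne_zero_of_mul h0)
        fun h => h0 (mul_eq_zero_of_outDist_eq_zero hW hP h x)]
      ring
  simp_rw [mutInfo, relEnt, Finset.mul_sum, h, Finset.sum_sub_distrib]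
  rw [Finset.sum_comm (f := fun x y => P x * W x y * Real.log (outDist P W y)), sub_eq_add_neg,
    ← Finset.sum_neg_distrib]
  congr 1
  refine Finset.sum_congr rfl fun y _ => ?_
  rw [← Finset.sum_mul, Real.negMulLog, neg_mul, outDist]

lemma sum_mul_relEnt (hW : IsChannel W) (hP : ∀ x, 0 ≤ P x) {Q : Y → ℝ}
    (hQ : ∀ y, Q y = 0 → outDist P W y = 0) :
    ∑ x, P x * relEnt (W x) Q = mutInfo P W + relEnt (outDist P W) Q := by
  have h : ∀ x y, P x * (W x y * Real.log (W x y / Q y)) =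
      P x * (W x y * Real.log (W x y / outDist P W y)) +
        P x * W x y * Real.log (outDist P W y / Q y) := by
    intro x y
    by_cases h0 : P x * W x y = 0
    · rcases mul_eq_zero.1 h0 with h1 | h1 <;> simp [h1]
    · have h1 := right_ne_zero_of_mul h0
      have h2 : outDist P W y ≠ 0 := fun h => h0 (mul_eq_zero_of_outDist_eq_zero hW hP h x)
      have h3 : Q y ≠ 0 := fun h => h2 (hQ y h)
      rw [Real.log_div h1 h3, Real.log_div h1 h2, Real.log_div h2 h3]
      ring
  simp_rw [mutInfo, relEnt, Finset.mul_sum, h, Finset.sum_add_distrib]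
  congr 1
  rw [Finset.sum_comm]
  refine Finset.sum_congr rfl fun y _ => ?_
  rw [← Finset.sum_mul, outDist]

lemma exists_isMaxOn_mutInfo [Nonempty X] (hW : IsChannel W) :
    ∃ P : X → ℝ, IsDist P ∧ ∀ P', IsDist P' → mutInfo P' W ≤ mutInfo P W := by
  classical
  have hcont : ContinuousOn (fun P : X → ℝ => mutInfo P W) (stdSimplex ℝ X) := by
    have hc : Continuous fun P : X → ℝ => ∑ x, P x * ∑ y, W x y * Real.log (W x y) +
        ∑ y, Real.negMulLog (outDist P W y) := by
      unfold outDist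
      fun_prop
    exact hc.continuousOn.congr fun P hP => mutInfo_eq hW hP.1
  obtain ⟨P, hP, hmax⟩ := (isCompact_stdSimplex ℝ X).exists_isMaxOn
    ⟨_, single_mem_stdSimplex ℝ (Classical.arbitrary X)⟩ hcont
  exact ⟨P, hP, fun P' hP' => hmax hP'⟩

lemma mutInfo_le_capacity [Nonempty X] (hW : IsChannel W) (hP : IsDist P) :
    mutInfo P W ≤ capacity W := by
  obtain ⟨P₀, _, hmax⟩ := exists_isMaxOn_mutInfo hW
  refine le_csSup ⟨mutInfo P₀ W, ?_⟩ ⟨P, hP, rfl⟩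
  rintro c ⟨P', hP', rfl⟩
  exact hmax P' hP'

lemma exists_isCAID [Nonempty X] (hW : IsChannel W) : ∃ P : X → ℝ, isCAID W P := by
  obtain ⟨P, hP, hmax⟩ := exists_isMaxOn_mutInfo hW
  refine ⟨P, hP, le_antisymm (mutInfo_le_capacity hW hP) (csSup_le ⟨_, P, hP, rfl⟩ ?_)⟩
  rintro c ⟨P', hP', rfl⟩
  exact hmax P' hP'

/-- The divergence from `W x` to the output distribution of the input that mixes a
capacity-achieving `P` with the symbol `x` is at most the capacity. -/
lemma relEnt_mix_le_capacity [Nonempty X] (hW : IsChannel W) (hP : isCAID W P) (x : X) {t : ℝ}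
    (ht : t ∈ Set.Ioo (0 : ℝ) 1) :
    relEnt (W x) (fun y => (1 - t) * outDist P W y + t * W x y) ≤ capacity W := by
  classical
  obtain ⟨ht0, ht1⟩ := ht
  have ht1' : 0 < 1 - t := by linarith
  set Pt : X → ℝ := fun x' => (1 - t) * P x' + t * (if x' = x then 1 else 0) with hPt
  set Qt : Y → ℝ := fun y => (1 - t) * outDist P W y + t * W x y with hQt
  have hout : outDist Pt W = Qt := by
    funext y
    simp only [hPt, hQt, outDist, add_mul, Finset.sum_add_distrib, mul_assoc, ← Finset.mul_sum,
      ite_mul, one_mul, zero_mul, Finset.sum_ite_eq', Finset.mem_univ, if_true]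
  have hPtd : IsDist Pt := by
    refine ⟨fun x' => ?_, ?_⟩
    · have := hP.1.1 x'
      simp only [hPt]
      split_ifs <;> positivity
    · simp [hPt, Finset.sum_add_distrib, ← Finset.mul_sum, hP.1.2]
  have hQd : IsDist Qt := hout ▸ isDist_outDist hW hPtd
  have hQ0 : ∀ y, Qt y = 0 → outDist P W y = 0 := by
    intro y hy
    have h1 := mul_nonneg ht1'.le ((isDist_outDist hW hP.1).1 y)
    have h2 := mul_nonneg ht0.le ((hW x).1 y)
    have h3 : (1 - t) * outDist P W y = 0 := by simp only [hQt] at hy; linarith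
    exact (mul_eq_zero.1 h3).resolve_left ht1'.ne'
  have hI : mutInfo Pt W = (1 - t) * ∑ x', P x' * relEnt (W x') Qt + t * relEnt (W x) Qt := by
    rw [mutInfo, hout]
    simp [hPt, add_mul, Finset.sum_add_distrib, mul_assoc, ← Finset.mul_sum]
  rw [sum_mul_relEnt hW hP.1.1 hQ0, hP.2] at hI
  have hle := mutInfo_le_capacity hW hPtd
  have hnn := relEnt_nonneg (isDist_outDist hW hP.1) hQd hQ0
  have h4 : t * relEnt (W x) Qt ≤ t * capacity W := by
    nlinarith [mul_nonneg ht1'.le hnn]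
  exact le_of_mul_le_mul_left h4 ht0

lemma IsDist.le_one {Z : Type*} [Fintype Z] {P : Z → ℝ} (hP : IsDist P) (z : Z) : P z ≤ 1 :=
  hP.2 ▸ Finset.single_le_sum (fun z _ => hP.1 z) (Finset.mem_univ z)

lemma eq_zero_of_outDist_eq_zero [Nonempty X] (hW : IsChannel W) (hP : isCAID W P) (x : X) {y : Y}
    (hy : outDist P W y = 0) : W x y = 0 := by
  classical
  by_contra hne
  have hpos : 0 < W x y := lt_of_le_of_ne ((hW x).1 y) (Ne.symm hne)
  have hQ := isDist_outDist hW hP.1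
  set S := ∑ z ∈ Finset.univ.erase y, W x z * Real.log (W x z)
  set M := (|capacity W - S| + 1) / W x y with hM
  have hMpos : 0 < M := by positivity
  have ht : Real.exp (-M) ∈ Set.Ioo (0 : ℝ) 1 := ⟨Real.exp_pos _, by simpa using hMpos⟩
  have h := relEnt_mix_le_capacity hW hP x ht
  rw [relEnt, ← Finset.add_sum_erase _ _ (Finset.mem_univ y)] at h
  have h1 : W x y * Real.log (W x y / ((1 - Real.exp (-M)) * outDist P W y +
      Real.exp (-M) * W x y)) = W x y * M := by
    rw [hy, mul_zero, zero_add, div_mul_cancel_right₀ hne, ← Real.exp_neg, Real.log_exp, neg_neg]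
  have h2 : S ≤ ∑ z ∈ Finset.univ.erase y, W x z * Real.log (W x z /
      ((1 - Real.exp (-M)) * outDist P W z + Real.exp (-M) * W x z)) := by
    refine Finset.sum_le_sum fun z _ => ?_
    rcases ((hW x).1 z).eq_or_lt with h0 | h0
    · simp [← h0]
    · have hb := hQ.le_one z
      have hb' := (hW x).le_one z
      have h1t : 0 ≤ 1 - Real.exp (-M) := by linarith [ht.2]
      have hq : 0 < (1 - Real.exp (-M)) * outDist P W z + Real.exp (-M) * W x z :=
        add_pos_of_nonneg_of_pos (mul_nonneg h1t (hQ.1 z)) (mul_pos ht.1 h0)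
      have hq1 : (1 - Real.exp (-M)) * outDist P W z + Real.exp (-M) * W x z ≤ 1 := by
        nlinarith [ht.1]
      refine mul_le_mul_of_nonneg_left (Real.log_le_log h0 ?_) h0.le
      rw [le_div_iff₀ hq]
      nlinarith
  have h3 : W x y * M = |capacity W - S| + 1 := by
    rw [hM]; field_simp
  rw [h1, h3] at h
  linarith [le_abs_self (capacity W - S)]

lemma relEnt_le_capacity [Nonempty X] (hW : IsChannel W) (hP : isCAID W P) (x : X) :
    relEnt (W x) (outDist P W) ≤ capacity W := by
  have hlim : Filter.Tendsto (fun t : ℝ => relEnt (W x)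
      (fun y => (1 - t) * outDist P W y + t * W x y)) (nhdsWithin 0 (Set.Ioi 0))
      (nhds (relEnt (W x) (outDist P W))) := by
    refine tendsto_nhdsWithin_of_tendsto_nhds (tendsto_finsetSum _ fun y _ => ?_)
    by_cases hy : W x y = 0
    · simp [hy]
    · have hq : outDist P W y ≠ 0 := fun h => hy (eq_zero_of_outDist_eq_zero hW hP x h)
      have hc : ContinuousAt (fun t : ℝ => W x y * Real.log (W x y /
          ((1 - t) * outDist P W y + t * W x y))) 0 := by
        refine continuousAt_const.mul (ContinuousAt.log (continuousAt_const.div ?_ ?_) ?_)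
        · fun_prop
        · simpa using hq
        · simpa using ⟨hy, hq⟩
      simpa [ContinuousAt] using hc
  refine le_of_tendsto hlim ?_
  filter_upwards [Ioo_mem_nhdsGT (zero_lt_one (α := ℝ))] with t ht
  exact relEnt_mix_le_capacity hW hP x ht

/-- The capacity-achieving output distribution is unique. -/
lemma outDist_eq_of_isCAID [Nonempty X] (hW : IsChannel W) {P' : X → ℝ} (hP : isCAID W P)
    (hP' : isCAID W P') : outDist P' W = outDist P W := by
  have hac : ∀ y, outDist P W y = 0 → outDist P' W y = 0 := fun y hy =>
    Finset.sum_eq_zero fun x _ => by rw [eq_zero_of_outDist_eq_zero hW hP x hy, mul_zero]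
  have h1 := sum_mul_relEnt hW hP'.1.1 hac
  have h2 : ∑ x, P' x * relEnt (W x) (outDist P W) ≤ ∑ x, P' x * capacity W :=
    Finset.sum_le_sum fun x _ =>
      mul_le_mul_of_nonneg_left (relEnt_le_capacity hW hP x) (hP'.1.1 x)
  rw [← Finset.sum_mul, hP'.1.2, one_mul, h1, hP'.2] at h2
  exact eq_of_relEnt_nonpos (isDist_outDist hW hP'.1) (isDist_outDist hW hP.1) hac (by linarith)

lemma capacity_nonneg [Nonempty X] (hW : IsChannel W) : 0 ≤ capacity W := by
  obtain ⟨P, hP⟩ := exists_isCAID hW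
  exact (relEnt_nonneg (hW (Classical.arbitrary X)) (isDist_outDist hW hP.1)
    fun y hy => eq_zero_of_outDist_eq_zero hW hP _ hy).trans (relEnt_le_capacity hW hP _)

end Capacity

/-! ### Expectations under finite product distributions -/

/-- Expectation of `F` under the product of the distributions `p i`. -/
noncomputable def prodExp {Y : Type*} [Fintype Y] {n : ℕ} (p : Fin n → Y → ℝ)
    (F : (Fin n → Y) → ℝ) : ℝ :=
  ∑ ys, (∏ i, p i (ys i)) * F ys

section ProdExp

variable {Y : Type*} [Fintype Y] {n : ℕ}

lemma prodExp_succ (p : Fin (n + 1) → Y → ℝ) (F : (Fin (n + 1) → Y) → ℝ) :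
    prodExp p F =
      ∑ y, p 0 y * prodExp (fun i => p i.succ) (fun ys => F (Fin.cons y ys)) := by
  unfold prodExp
  rw [← (Fin.consEquiv fun _ => Y).sum_comp, Fintype.sum_prod_type]
  simp [Fin.prod_univ_succ, Fin.consEquiv, Finset.mul_sum, mul_assoc]

lemma sum_prod_eq_one {p : Fin n → Y → ℝ} (hp : ∀ i, IsDist (p i)) :
    ∑ ys : Fin n → Y, ∏ i, p i (ys i) = 1 := by
  rw [← Fintype.prod_sum]
  simp [(hp _).2]

lemma prodExp_mono_of_ne_zero {p : Fin n → Y → ℝ} (hp : ∀ i, IsDist (p i))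
    {F G : (Fin n → Y) → ℝ} (h : ∀ ys, (∀ i, p i (ys i) ≠ 0) → F ys ≤ G ys) :
    prodExp p F ≤ prodExp p G := by
  refine Finset.sum_le_sum fun ys _ => ?_
  by_cases h0 : ∏ i, p i (ys i) = 0
  · simp [h0]
  · exact mul_le_mul_of_nonneg_left (h ys fun i => Finset.prod_ne_zero_iff.1 h0 i (Finset.mem_univ i))
      (Finset.prod_nonneg fun i _ => (hp i).1 _)

lemma prodExp_mono {p : Fin n → Y → ℝ} (hp : ∀ i, IsDist (p i))
    {F G : (Fin n → Y) → ℝ} (h : ∀ ys, F ys ≤ G ys) : prodExp p F ≤ prodExp p G :=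
  prodExp_mono_of_ne_zero hp fun ys _ => h ys

lemma prodExp_add (p : Fin n → Y → ℝ) (F G : (Fin n → Y) → ℝ) :
    prodExp p (fun ys => F ys + G ys) = prodExp p F + prodExp p G := by
  simp [prodExp, mul_add, Finset.sum_add_distrib]

/-- Second moment of a shifted sum of independent centred variables. -/
lemma prodExp_sq (p g : Fin n → Y → ℝ) (v : Fin n → ℝ) (hp : ∀ i, IsDist (p i))
    (hmean : ∀ i, ∑ y, p i y * g i y = 0) (hvar : ∀ i, ∑ y, p i y * g i y ^ 2 = v i) (t : ℝ) :
    prodExp p (fun ys => (t + ∑ i, g i (ys i)) ^ 2) = t ^ 2 + ∑ i, v i := by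
  induction n generalizing t with
  | zero => simp [prodExp]
  | succ n ih =>
    rw [prodExp_succ]
    simp_rw [Fin.sum_univ_succ, Fin.cons_zero, Fin.cons_succ, ← add_assoc]
    simp_rw [ih (fun i => p i.succ) (fun i => g i.succ) (fun i => v i.succ) (fun i => hp _)
      (fun i => hmean _) (fun i => hvar _)]
    have h : ∀ y, p 0 y * ((t + g 0 y) ^ 2 + ∑ i : Fin n, v i.succ) =
        p 0 y * (t ^ 2 + ∑ i : Fin n, v i.succ) + 2 * t * (p 0 y * g 0 y) +
          p 0 y * g 0 y ^ 2 := fun y => by ring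
    simp_rw [h, Finset.sum_add_distrib, ← Finset.sum_mul, ← Finset.mul_sum, hmean, hvar, (hp _).2]
    ring

open Classical in
/-- One-sided Chebyshev bound for sums of independent variables with nonpositive means. -/
lemma prodExp_tail_le (p g : Fin n → Y → ℝ) (m v : Fin n → ℝ) (hp : ∀ i, IsDist (p i))
    (hmean : ∀ i, ∑ y, p i y * g i y = -m i) (hm : ∀ i, 0 ≤ m i)
    (hvar : ∀ i, ∑ y, p i y * (g i y + m i) ^ 2 = v i) {K : ℝ} (hK : 0 < K) :
    prodExp p (fun ys => if K < ∑ i, g i (ys i) then 1 else 0) ≤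
      (∑ i, v i) / (K + ∑ i, m i) ^ 2 := by
  have hM : 0 ≤ ∑ i, m i := Finset.sum_nonneg fun i _ => hm i
  have hpos : 0 < K + ∑ i, m i := by linarith
  have h0 := prodExp_sq p (fun i y => g i y + m i) v hp
    (fun i => by simp [mul_add, Finset.sum_add_distrib, hmean, ← Finset.sum_mul, (hp i).2]) hvar 0
  rw [le_div_iff₀ (by positivity)]
  have h1 : prodExp p (fun ys => if K < ∑ i, g i (ys i) then 1 else 0) * (K + ∑ i, m i) ^ 2 =
      prodExp p (fun ys => if K < ∑ i, g i (ys i) then (K + ∑ i, m i) ^ 2 else 0) := by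
    simp only [prodExp, Finset.sum_mul, mul_assoc, ite_mul, one_mul, zero_mul]
  rw [h1]
  refine le_trans (prodExp_mono hp fun ys => ?_) (h0.trans (by simp)).le
  split_ifs with h
  · rw [zero_add, Finset.sum_add_distrib]
    exact pow_le_pow_left₀ hpos.le (by linarith) 2
  · positivity

end ProdExp

/-! ### A quantitative comparison with Gaussian sums -/

/-- A function satisfies a second order Taylor estimate with constant `L`. -/
def HasCubicRemainder (f : ℝ → ℝ) (L : ℝ) : Prop :=
  ∃ f₁ f₂ : ℝ → ℝ, ∀ t x, |f (t + x) - (f t + f₁ t * x + f₂ t * x ^ 2)| ≤ L * |x| ^ 3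

lemma abs_sub_le_of_abs_deriv_le {h h' : ℝ → ℝ} (hd : ∀ u, HasDerivAt h (h' u) u) {x B : ℝ}
    (hB : ∀ u ∈ Set.uIcc 0 x, |h' u| ≤ B) {u : ℝ} (hu : u ∈ Set.uIcc 0 x) :
    |h u - h 0| ≤ B * |u| := by
  simpa using (convex_uIcc 0 x).norm_image_sub_le_of_norm_hasDerivWithin_le
    (fun w _ => (hd w).hasDerivWithinAt) hB Set.left_mem_uIcc hu

lemma abs_le_of_mem_uIcc_zero {x u : ℝ} (hu : u ∈ Set.uIcc 0 x) : |u| ≤ |x| := by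
  simpa using Set.abs_sub_left_of_mem_uIcc hu

lemma hasCubicRemainder_of_contDiff {f : ℝ → ℝ} (hf : ContDiff ℝ 3 f) {L : ℝ}
    (hL : ∀ t, |iteratedDeriv 3 f t| ≤ L) : HasCubicRemainder f L := by
  have hd : ∀ k < 3, ∀ t, HasDerivAt (iteratedDeriv k f) (iteratedDeriv (k + 1) f t) t := by
    intro k hk t
    rw [iteratedDeriv_succ]
    exact (hf.differentiable_iteratedDeriv k (by exact_mod_cast hk) t).hasDerivAt
  refine ⟨iteratedDeriv 1 f, fun t => iteratedDeriv 2 f t / 2, fun t x => ?_⟩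
  have hd' : ∀ k < 3, ∀ u, HasDerivAt (fun u => iteratedDeriv k f (t + u))
      (iteratedDeriv (k + 1) f (t + u)) u := fun k hk u => (hd k hk (t + u)).comp_const_add t u
  have h2 : ∀ u ∈ Set.uIcc 0 x, |iteratedDeriv 2 f (t + u) - iteratedDeriv 2 f t| ≤ L * |x| := by
    intro u hu
    have := abs_sub_le_of_abs_deriv_le (hd' 2 (by norm_num)) (fun u _ => hL (t + u)) hu
    rw [add_zero] at this
    exact this.trans (mul_le_mul_of_nonneg_left (abs_le_of_mem_uIcc_zero hu)
      ((abs_nonneg _).trans (hL t)))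
  have hL0 : 0 ≤ L := (abs_nonneg _).trans (hL t)
  have h1 : ∀ u ∈ Set.uIcc 0 x, |iteratedDeriv 1 f (t + u) -
      (iteratedDeriv 1 f t + iteratedDeriv 2 f t * u)| ≤ L * |x| * |x| := by
    intro u hu
    have := abs_sub_le_of_abs_deriv_le (h := fun u => iteratedDeriv 1 f (t + u) -
      (iteratedDeriv 1 f t + iteratedDeriv 2 f t * u))
      (h' := fun u => iteratedDeriv 2 f (t + u) - iteratedDeriv 2 f t)
      (fun u => (hd' 1 (by norm_num) u).sub (by
        simpa using ((hasDerivAt_id u).const_mul (iteratedDeriv 2 f t)).const_add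
          (iteratedDeriv 1 f t))) h2 hu
    simp only [add_zero, mul_zero, sub_self, sub_zero] at this
    exact this.trans (mul_le_mul_of_nonneg_left (abs_le_of_mem_uIcc_zero hu) (by positivity))
  have h0 := abs_sub_le_of_abs_deriv_le (h := fun u => f (t + u) -
      (f t + iteratedDeriv 1 f t * u + iteratedDeriv 2 f t / 2 * u ^ 2))
      (h' := fun u => iteratedDeriv 1 f (t + u) - (iteratedDeriv 1 f t + iteratedDeriv 2 f t * u))
      (fun u => by
        have h := hd' 0 (by norm_num) u
        simp only [iteratedDeriv_zero, zero_add] at h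
        refine h.sub ?_
        have h5 := (((hasDerivAt_id u).const_mul (iteratedDeriv 1 f t)).const_add (f t)).add
          (((hasDerivAt_id u).pow 2).const_mul (iteratedDeriv 2 f t / 2))
        convert! h5 using 1
        simp
        ring) h1 Set.right_mem_uIcc
  simp only [add_zero, mul_zero, ne_eq, OfNat.ofNat_ne_zero, not_false_eq_true, zero_pow, sub_self,
    sub_zero] at h0
  exact h0.trans (by rw [pow_three]; nlinarith)

lemma HasCubicRemainder.comp_affine {f : ℝ → ℝ} {L : ℝ} (hf : HasCubicRemainder f L) {b : ℝ}
    (hb : 0 < b) (c : ℝ) : HasCubicRemainder (fun t => f (t / b + c)) (L / b ^ 3) := by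
  obtain ⟨f₁, f₂, h⟩ := hf
  refine ⟨fun t => f₁ (t / b + c) / b, fun t => f₂ (t / b + c) / b ^ 2, fun t x => ?_⟩
  have h1 := h (t / b + c) (x / b)
  rw [abs_div, abs_of_pos hb] at h1
  convert! h1 using 1
  · congr 1
    beta_reduce
    rw [show (t + x) / b + c = t / b + c + x / b by ring]
    ring
  · ring

lemma exists_hasCubicRemainder_smoothTransition :
    ∃ L, 0 ≤ L ∧ HasCubicRemainder Real.smoothTransition L := by
  have hcd : ContDiff ℝ 3 Real.smoothTransition :=
    Real.smoothTransition.contDiff (n := 3)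
  have hc : Continuous (iteratedDeriv 3 Real.smoothTransition) :=
    hcd.continuous_iteratedDeriv 3 le_rfl
  have hz : ∀ (t c : ℝ), Real.smoothTransition =ᶠ[nhds t] (fun _ => c) →
      iteratedDeriv 3 Real.smoothTransition t = 0 := by
    intro t c h
    rw [h.iteratedDeriv_eq 3]
    simp [iteratedDeriv_const]
  obtain ⟨L, hL⟩ := (isCompact_Icc (a := (0 : ℝ)) (b := 1)).exists_bound_of_continuousOn
    hc.continuousOn
  have hL0 : 0 ≤ L := (norm_nonneg _).trans (hL 0 (by simp))
  refine ⟨L, hL0, hasCubicRemainder_of_contDiff hcd fun t => ?_⟩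
  by_cases ht : t ∈ Set.Icc (0 : ℝ) 1
  · exact hL t ht
  · rw [Set.mem_Icc, not_and_or, not_le, not_le] at ht
    rcases ht with ht | ht
    · rw [hz t 0, abs_zero]
      · exact hL0
      · filter_upwards [Iio_mem_nhds ht] with u hu
        exact Real.smoothTransition.zero_of_nonpos (le_of_lt hu)
    · rw [hz t 1, abs_zero]
      · exact hL0
      · filter_upwards [Ioi_mem_nhds ht] with u hu
        exact Real.smoothTransition.one_of_one_le (le_of_lt hu)

open ProbabilityTheory in
lemma integrable_abs_pow_gaussianReal (v : NNReal) (k : ℕ) :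
    Integrable (fun z : ℝ => |z| ^ k) (gaussianReal 0 v) := by
  simpa using (memLp_id_gaussianReal (μ := 0) (v := v) k).integrable_norm_pow'

open ProbabilityTheory in
lemma integral_sq_gaussianReal (v : NNReal) : ∫ z, z ^ 2 ∂gaussianReal 0 v = v := by
  have h := variance_of_integral_eq_zero (X := fun z : ℝ => z) (μ := gaussianReal 0 v)
    aemeasurable_id (by simp)
  rw [variance_fun_id_gaussianReal] at h
  exact h.symm

lemma integrable_of_continuous_of_abs_le {μ : Measure ℝ} [IsFiniteMeasure μ] {f : ℝ → ℝ}
    (hc : Continuous f) {B : ℝ} (hB : ∀ t, |f t| ≤ B) : Integrable f μ :=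
  Integrable.of_bound hc.aestronglyMeasurable B (Filter.Eventually.of_forall hB)

open ProbabilityTheory in
/-- Replacing a centred finite variable by a Gaussian of the same variance changes the
expectation of a smooth test function by at most third absolute moments. -/
lemma abs_sum_sub_integral_gaussianReal_le {Y : Type*} [Fintype Y] {p g : Y → ℝ} {v : NNReal}
    (hp : IsDist p) (hmean : ∑ y, p y * g y = 0) (hvar : ∑ y, p y * g y ^ 2 = v)
    {f : ℝ → ℝ} (hc : Continuous f) (hf1 : ∀ t, |f t| ≤ 1) {L : ℝ} (hf : HasCubicRemainder f L)
    (t : ℝ) :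
    |∑ y, p y * f (t + g y) - ∫ z, f (t + z) ∂gaussianReal 0 v| ≤
      L * (∑ y, p y * |g y| ^ 3 + ∫ z, |z| ^ 3 ∂gaussianReal 0 v) := by
  obtain ⟨f₁, f₂, h⟩ := hf
  have hsum : |∑ y, p y * f (t + g y) - (f t + f₂ t * v)| ≤ L * ∑ y, p y * |g y| ^ 3 := by
    have h1 : ∑ y, p y * f (t + g y) - (f t + f₂ t * v) =
        ∑ y, p y * (f (t + g y) - (f t + f₁ t * g y + f₂ t * g y ^ 2)) := by
      have h2 : ∀ y, p y * (f (t + g y) - (f t + f₁ t * g y + f₂ t * g y ^ 2)) =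
          p y * f (t + g y) - (p y * f t + f₁ t * (p y * g y) + f₂ t * (p y * g y ^ 2)) :=
        fun y => by ring
      simp_rw [h2, Finset.sum_sub_distrib, Finset.sum_add_distrib, ← Finset.mul_sum,
        ← Finset.sum_mul, hmean, hvar, hp.2]
      ring
    rw [h1, Finset.mul_sum]
    refine (Finset.abs_sum_le_sum_abs _ _).trans (Finset.sum_le_sum fun y _ => ?_)
    rw [abs_mul, abs_of_nonneg (hp.1 y), mul_left_comm]
    exact mul_le_mul_of_nonneg_left (h t (g y)) (hp.1 y)
  have hint : |∫ z, f (t + z) ∂gaussianReal 0 v - (f t + f₂ t * v)| ≤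
      L * ∫ z, |z| ^ 3 ∂gaussianReal 0 v := by
    have hi1 : Integrable (fun z : ℝ => z) (gaussianReal 0 v) := by
      have := (integrable_abs_pow_gaussianReal v 1)
      simp only [pow_one] at this
      exact (integrable_norm_iff aestronglyMeasurable_id).1 this
    have hi2 : Integrable (fun z : ℝ => z ^ 2) (gaussianReal 0 v) := by
      simpa using integrable_abs_pow_gaussianReal v 2
    have hif : Integrable (fun z : ℝ => f (t + z)) (gaussianReal 0 v) :=
      integrable_of_continuous_of_abs_le (by fun_prop) fun z => hf1 _
    have hip : Integrable (fun z : ℝ => f t + f₁ t * z + f₂ t * z ^ 2) (gaussianReal 0 v) :=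
      ((integrable_const _).add (hi1.const_mul _)).add (hi2.const_mul _)
    have hi0 : Integrable (fun z : ℝ => f t + f₁ t * z) (gaussianReal 0 v) :=
      (integrable_const _).add (hi1.const_mul _)
    have h1 : ∫ z, f (t + z) ∂gaussianReal 0 v - (f t + f₂ t * v) =
        ∫ z, (f (t + z) - (f t + f₁ t * z + f₂ t * z ^ 2)) ∂gaussianReal 0 v := by
      rw [integral_sub hif hip, integral_add hi0 (hi2.const_mul _), integral_add (integrable_const _) (hi1.const_mul _),
        integral_const_mul, integral_const_mul, integral_sq_gaussianReal,
        integral_id_gaussianReal]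
      simp
    rw [h1, ← integral_const_mul]
    rw [← Real.norm_eq_abs]
    exact norm_integral_le_of_norm_le ((integrable_abs_pow_gaussianReal v 3).const_mul L)
      (Filter.Eventually.of_forall (h t))
  rw [mul_add]
  refine (abs_sub_le _ (f t + f₂ t * v) _).trans (add_le_add hsum ?_)
  rwa [abs_sub_comm]

open ProbabilityTheory in
lemma integral_integral_gaussianReal_add {f : ℝ → ℝ} (hc : Continuous f) (hf1 : ∀ t, |f t| ≤ 1)
    (v w : NNReal) (t : ℝ) :
    ∫ z, ∫ z', f (t + z + z') ∂gaussianReal 0 w ∂gaussianReal 0 v =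
      ∫ z, f (t + z) ∂gaussianReal 0 (w + v) := by
  have h : gaussianReal 0 v ∗ gaussianReal 0 w = gaussianReal 0 (w + v) := by
    rw [gaussianReal_conv_gaussianReal, add_zero, add_comm w v]
  rw [← h, Measure.conv, integral_map (by fun_prop)
    (Continuous.aestronglyMeasurable (by fun_prop)), integral_prod]
  · simp only [add_assoc]
  · exact Integrable.of_bound (Continuous.aestronglyMeasurable (by fun_prop)) 1
      (Filter.Eventually.of_forall fun z => hf1 _)

open ProbabilityTheory in
/-- Lindeberg's replacement principle for finite product distributions. -/
lemma abs_prodExp_sub_integral_gaussianReal_le {Y : Type*} [Fintype Y] {n : ℕ}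
    (p g : Fin n → Y → ℝ) (v : Fin n → NNReal) (e : Fin n → ℝ) (hp : ∀ i, IsDist (p i))
    {f : ℝ → ℝ} (hc : Continuous f) (hf1 : ∀ t, |f t| ≤ 1)
    (he : ∀ i t, |∑ y, p i y * f (t + g i y) - ∫ z, f (t + z) ∂gaussianReal 0 (v i)| ≤ e i)
    (t : ℝ) :
    |prodExp p (fun ys => f (t + ∑ i, g i (ys i))) - ∫ z, f (t + z) ∂gaussianReal 0 (∑ i, v i)| ≤
      ∑ i, e i := by
  induction n generalizing t with
  | zero => simp [prodExp]
  | succ n ih =>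
    set V : NNReal := ∑ i : Fin n, v i.succ with hV
    have hstep : ∀ s, |prodExp (fun i => p i.succ) (fun ys => f (s + ∑ i, g (Fin.succ i) (ys i))) -
        ∫ z, f (s + z) ∂gaussianReal 0 V| ≤ ∑ i : Fin n, e i.succ := fun s =>
      ih (fun i => p i.succ) (fun i => g i.succ) (fun i => v i.succ) (fun i => e i.succ)
        (fun i => hp _) (fun i => he _) s
    have hi : ∀ s, Integrable (fun z : ℝ => f (s + z)) (gaussianReal 0 V) := fun s =>
      integrable_of_continuous_of_abs_le (by fun_prop) fun z => hf1 _
    rw [prodExp_succ]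
    simp_rw [Fin.sum_univ_succ, Fin.cons_zero, Fin.cons_succ, ← add_assoc]
    have h1 : |∑ y, p 0 y * prodExp (fun i => p i.succ)
          (fun ys => f (t + g 0 y + ∑ i, g (Fin.succ i) (ys i))) -
        ∑ y, p 0 y * ∫ z, f (t + g 0 y + z) ∂gaussianReal 0 V| ≤ ∑ i : Fin n, e i.succ := by
      rw [← Finset.sum_sub_distrib]
      simp_rw [← mul_sub]
      refine (Finset.abs_sum_le_sum_abs _ _).trans ?_
      calc _ ≤ ∑ y, p 0 y * ∑ i : Fin n, e i.succ := Finset.sum_le_sum fun y _ => by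
            rw [abs_mul, abs_of_nonneg ((hp 0).1 y)]
            exact mul_le_mul_of_nonneg_left (hstep _) ((hp 0).1 y)
        _ = _ := by rw [← Finset.sum_mul, (hp 0).2, one_mul]
    have h2 : ∑ y, p 0 y * ∫ z, f (t + g 0 y + z) ∂gaussianReal 0 V =
        ∫ z, ∑ y, p 0 y * f (t + z + g 0 y) ∂gaussianReal 0 V := by
      rw [integral_finsetSum _ fun y _ => by
        simpa only [add_right_comm] using (hi (t + g 0 y)).const_mul (p 0 y)]
      simp_rw [integral_const_mul, add_right_comm]
    have h3 : |∫ z, ∑ y, p 0 y * f (t + z + g 0 y) ∂gaussianReal 0 V -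
        ∫ z, f (t + z) ∂gaussianReal 0 (v 0 + V)| ≤ e 0 := by
      have hi3 : Integrable (fun z : ℝ => ∑ y, p 0 y * f (t + z + g 0 y)) (gaussianReal 0 V) :=
        integrable_finsetSum _ fun y _ => by
          simpa only [add_right_comm] using (hi (t + g 0 y)).const_mul (p 0 y)
      have hm : Measurable fun z : ℝ => ∫ z', f (t + z + z') ∂gaussianReal 0 (v 0) := by
        have : StronglyMeasurable (fun q : ℝ × ℝ => f (t + q.1 + q.2)) :=
          Continuous.stronglyMeasurable (by fun_prop)
        exact this.integral_prod_right.measurable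
      have hi4 : Integrable (fun z : ℝ => ∫ z', f (t + z + z') ∂gaussianReal 0 (v 0))
          (gaussianReal 0 V) := by
        refine Integrable.of_bound hm.aestronglyMeasurable 1 (Filter.Eventually.of_forall fun z => ?_)
        simpa using norm_integral_le_of_norm_le_const (μ := gaussianReal 0 (v 0))
          (f := fun z' => f (t + z + z')) (Filter.Eventually.of_forall fun z' => hf1 (t + z + z'))
      rw [← integral_integral_gaussianReal_add hc hf1, ← integral_sub hi3 hi4]
      simpa using norm_integral_le_of_norm_le_const (μ := gaussianReal 0 V)
        (f := fun z => ∑ y, p 0 y * f (t + z + g 0 y) - ∫ z', f (t + z + z') ∂gaussianReal 0 (v 0))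
        (Filter.Eventually.of_forall fun z => he 0 (t + z))
    rw [h2] at h1
    rw [add_comm (e 0)]
    exact (abs_sub_le _ _ _).trans (add_le_add h1 h3)

open ProbabilityTheory in
lemma gaussianReal_real_Ioi_zero : (gaussianReal 0 1).real (Set.Ioi 0) ≤ 1 / 2 := by
  have hneg : (gaussianReal 0 1).real (Set.Iio 0) = (gaussianReal 0 1).real (Set.Ioi 0) := by
    have h := gaussianReal_map_neg (μ := 0) (v := 1)
    rw [neg_zero] at h
    conv_rhs => rw [← h]
    rw [map_measureReal_apply measurable_neg measurableSet_Ioi]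
    congr 1
    ext z
    simp
  have hle : (gaussianReal 0 1).real (Set.Iio 0 ∪ Set.Ioi 0) ≤ 1 := measureReal_le_one
  rw [measureReal_union (by
    rw [Set.disjoint_left]
    exact fun z (hz : z < 0) (hz' : 0 < z) => lt_asymm hz hz') measurableSet_Ioi, hneg] at hle
  linarith

open ProbabilityTheory in
/-- Slightly enlarging the positive half-line increases its Gaussian mass only slightly. -/
lemma exists_gaussianReal_real_Ioi_le {η : ℝ} (hη : 0 < η) :
    ∃ a, 0 < a ∧ (gaussianReal 0 1).real (Set.Ioi (-a)) ≤ 1 / 2 + η := by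
  refine ⟨η, hη, ?_⟩
  have h1 : (gaussianReal 0 1).real (Set.Ioc (-η) 0) ≤ η := by
    have hb : ∀ z, gaussianPDFReal 0 1 z ≤ 1 := by
      intro z
      rw [gaussianPDFReal_def]
      have hpi : (1 : ℝ) ≤ Real.sqrt (2 * Real.pi * ((1 : NNReal) : ℝ)) := by
        rw [Real.one_le_sqrt, NNReal.coe_one]
        linarith [Real.pi_gt_three]
      have hexp : Real.exp (-(z - 0) ^ 2 / (2 * ((1 : NNReal) : ℝ))) ≤ 1 := by
        rw [Real.exp_le_one_iff, NNReal.coe_one]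
        nlinarith [sq_nonneg (z - 0)]
      exact mul_le_one₀ (inv_le_one_of_one_le₀ hpi) (Real.exp_pos _).le hexp
    rw [measureReal_def, gaussianReal_apply_eq_integral 0 one_ne_zero,
      ENNReal.toReal_ofReal (integral_nonneg fun z => gaussianPDFReal_nonneg _ _ _)]
    have h2 := setIntegral_mono_on (μ := volume) (s := Set.Ioc (-η) 0)
      (integrable_gaussianPDFReal 0 1).integrableOn
      (integrableOn_const (C := (1 : ℝ)) (by simp)) measurableSet_Ioc fun z _ => hb z
    simpa [hη.le] using h2
  have hU : Set.Ioi (-η) = Set.Ioc (-η) 0 ∪ Set.Ioi 0 :=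
    (Set.Ioc_union_Ioi_eq_Ioi (by linarith)).symm
  rw [hU]
  linarith [measureReal_union_le (μ := gaussianReal 0 1) (Set.Ioc (-η) 0) (Set.Ioi 0),
    gaussianReal_real_Ioi_zero]

open ProbabilityTheory in
lemma gaussianReal_real_Ioi_mul_sqrt {V : NNReal} (hV : 0 < V) (a : ℝ) :
    (gaussianReal 0 V).real (Set.Ioi (-(a * Real.sqrt V))) =
      (gaussianReal 0 1).real (Set.Ioi (-a)) := by
  have hs : 0 < Real.sqrt V := Real.sqrt_pos.2 hV
  have h := gaussianReal_map_const_mul (μ := 0) (v := 1) (Real.sqrt V)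
  have hv : NNReal.mk (Real.sqrt V ^ 2) (sq_nonneg _) * 1 = V := by
    ext
    simp
  rw [mul_zero, hv] at h
  rw [← h, map_measureReal_apply (by fun_prop) measurableSet_Ioi]
  congr 1
  ext z
  simp only [Set.mem_preimage, Set.mem_Ioi]
  rw [show -(a * Real.sqrt V) = Real.sqrt V * -a by ring, mul_lt_mul_iff_right₀ hs]

lemma exists_le_const_mul {X : Type*} [Fintype X] (e v : X → ℝ) (hv : ∀ x, 0 ≤ v x)
    (h : ∀ x, v x = 0 → e x = 0) : ∃ c, 0 ≤ c ∧ ∀ x, e x ≤ c * v x := by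
  have hnn : ∀ x, 0 ≤ |e x| / v x := fun x => div_nonneg (abs_nonneg _) (hv x)
  refine ⟨∑ x, |e x| / v x, Finset.sum_nonneg fun x _ => hnn x, fun x => ?_⟩
  by_cases hx : v x = 0
  · simp [hx, h x hx]
  · calc e x ≤ |e x| := le_abs_self _
      _ = |e x| / v x * v x := by field_simp
      _ ≤ _ := mul_le_mul_of_nonneg_right
        (Finset.single_le_sum (fun x _ => hnn x) (Finset.mem_univ x)) (hv x)

section Tails

variable {X Y : Type*} [Fintype X] [Fintype Y] {W : X → Y → ℝ}

open Classical in
/-- Uniform tail bound for sums of independent variables, each of which is either almost surely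
zero or has negative mean. -/
lemma exists_prodExp_tail_le (hW : IsChannel W) (g : X → Y → ℝ) (m : X → ℝ) (hm : ∀ x, 0 ≤ m x)
    (hmean : ∀ x, ∑ y, W x y * g x y = -m x)
    (hvar : ∀ x, m x = 0 → ∑ y, W x y * (g x y + m x) ^ 2 = 0) {η : ℝ} (hη : 0 < η) :
    ∃ K₀, 0 < K₀ ∧ ∀ K, K₀ ≤ K → ∀ (n : ℕ) (xs : Fin n → X),
      prodExp (fun i => W (xs i)) (fun ys => if K < ∑ i, g (xs i) (ys i) then 1 else 0) ≤ η := by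
  obtain ⟨c, hc, hle⟩ := exists_le_const_mul _ m hm hvar
  refine ⟨c / η + 1, by positivity, fun K hK n xs => ?_⟩
  have hKpos : 0 < K := lt_of_lt_of_le (by positivity) hK
  refine (prodExp_tail_le _ (fun i => g (xs i)) (fun i => m (xs i)) _ (fun i => hW (xs i))
    (fun i => hmean _) (fun i => hm _) (fun i => rfl) hKpos).trans ?_
  set μ := ∑ i, m (xs i) with hμ
  have hμ0 : 0 ≤ μ := Finset.sum_nonneg fun i _ => hm _
  have hv : ∑ i, ∑ y, W (xs i) y * (g (xs i) y + m (xs i)) ^ 2 ≤ c * μ := by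
    rw [hμ, Finset.mul_sum]
    exact Finset.sum_le_sum fun i _ => hle (xs i)
  rw [div_le_iff₀ (by positivity)]
  refine hv.trans ?_
  have hcK : c ≤ η * K := by
    have : c / η ≤ K := by linarith
    rwa [div_le_iff₀' hη] at this
  calc c * μ ≤ η * K * μ := mul_le_mul_of_nonneg_right hcK hμ0
    _ = η * (K * μ) := by ring
    _ ≤ η * (K + μ) ^ 2 := mul_le_mul_of_nonneg_left (by nlinarith [mul_nonneg hKpos.le hμ0]) hη.le

open Classical ProbabilityTheory in
/-- Uniformly over sums of independent centred variables from a finite family, a sufficiently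
large constant is exceeded with probability at most slightly more than one half. -/
lemma exists_prodExp_tail_le_half (hW : IsChannel W) (g : X → Y → ℝ)
    (hmean : ∀ x, ∑ y, W x y * g x y = 0) {η : ℝ} (hη : 0 < η) :
    ∃ K₀, 0 < K₀ ∧ ∀ K, K₀ ≤ K → ∀ (n : ℕ) (xs : Fin n → X),
      prodExp (fun i => W (xs i)) (fun ys => if K < ∑ i, g (xs i) (ys i) then 1 else 0) ≤
        1 / 2 + η := by
  have hvnn : ∀ x, 0 ≤ ∑ y, W x y * g x y ^ 2 := fun x =>
    Finset.sum_nonneg fun y _ => mul_nonneg ((hW x).1 y) (sq_nonneg _)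
  set v : X → NNReal := fun x => ⟨∑ y, W x y * g x y ^ 2, hvnn x⟩ with hv
  have hvx : ∀ x, ∑ y, W x y * g x y ^ 2 = v x := fun x => rfl
  set ρ : X → ℝ := fun x => ∑ y, W x y * |g x y| ^ 3 + ∫ z, |z| ^ 3 ∂gaussianReal 0 (v x) with hρ
  have hρ0 : ∀ x, (v x : ℝ) = 0 → ρ x = 0 := by
    intro x hx
    have h1 : ∀ y, W x y * |g x y| ^ 3 = 0 := by
      intro y
      have h2 := (Finset.sum_eq_zero_iff_of_nonneg fun y _ =>
        mul_nonneg ((hW x).1 y) (sq_nonneg (g x y))).1 ((hvx x).trans hx) y (Finset.mem_univ y)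
      rcases mul_eq_zero.1 h2 with h3 | h3
      · simp [h3]
      · simp [pow_eq_zero_iff two_ne_zero |>.1 h3]
    have h4 : v x = 0 := by exact_mod_cast hx
    simp [hρ, h1, h4, gaussianReal_zero_var]
  obtain ⟨c, hc, hle⟩ := exists_le_const_mul ρ (fun x => (v x : ℝ)) hvnn hρ0
  obtain ⟨L, hL, hcub⟩ := exists_hasCubicRemainder_smoothTransition
  obtain ⟨a, ha, hgauss⟩ := exists_gaussianReal_real_Ioi_le (half_pos hη)
  set V₀ : ℝ := (2 * L * c / (a ^ 3 * η)) ^ 2 + 1 with hV₀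
  have hV₀pos : 0 < V₀ := by positivity
  refine ⟨2 * V₀ + 1, by positivity, fun K hK n xs => ?_⟩
  have hKpos : 0 < K := by linarith
  set V : NNReal := ∑ i, v (xs i) with hV
  have hVreal : ∑ i, (v (xs i) : ℝ) = V := by rw [hV, NNReal.coe_sum]
  rcases lt_or_ge (V : ℝ) V₀ with hsmall | hlarge
  · refine (prodExp_tail_le _ (fun i => g (xs i)) (fun i => 0) (fun i => v (xs i))
      (fun i => hW (xs i)) (fun i => by rw [hmean, neg_zero]) (fun i => le_rfl)
      (fun i => by simp_rw [add_zero]; exact hvx _) hKpos).trans ?_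
    rw [hVreal, Finset.sum_const_zero, add_zero, div_le_iff₀ (by positivity)]
    nlinarith
  · have hVpos : 0 < V := by
      have : (0 : ℝ) < V := hV₀pos.trans_le hlarge
      exact_mod_cast this
    set s := Real.sqrt V with hs
    have hspos : 0 < s := Real.sqrt_pos.2 hVpos
    have hs2 : s ^ 2 = V := Real.sq_sqrt V.2
    set b := a * s with hb
    have hbpos : 0 < b := mul_pos ha hspos
    set f : ℝ → ℝ := fun t => Real.smoothTransition (t / b + 1) with hf
    have hfc : Continuous f := Real.smoothTransition.continuous.comp (by fun_prop)
    have hf1 : ∀ t, |f t| ≤ 1 := fun t => by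
      rw [abs_of_nonneg (Real.smoothTransition.nonneg _)]
      exact Real.smoothTransition.le_one _
    have hfcub : HasCubicRemainder f (L / b ^ 3) := hcub.comp_affine hbpos 1
    have hlind := abs_prodExp_sub_integral_gaussianReal_le (fun i => W (xs i)) (fun i => g (xs i))
      (fun i => v (xs i)) (fun i => L / b ^ 3 * ρ (xs i)) (fun i => hW _) hfc hf1
      (fun i t => abs_sum_sub_integral_gaussianReal_le (hW _) (hmean _) (hvx _) hfc hf1 hfcub t) 0
    have hind : prodExp (fun i => W (xs i))
        (fun ys => if K < ∑ i, g (xs i) (ys i) then 1 else 0) ≤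
        prodExp (fun i => W (xs i)) (fun ys => f (0 + ∑ i, g (xs i) (ys i))) := by
      refine prodExp_mono (fun i => hW _) fun ys => ?_
      split_ifs with h
      · refine (Real.smoothTransition.one_of_one_le ?_).ge
        have : 0 ≤ (0 + ∑ i, g (xs i) (ys i)) / b := div_nonneg (by linarith) hbpos.le
        linarith
      · exact Real.smoothTransition.nonneg _
    have hint : ∫ z, f (0 + z) ∂gaussianReal 0 V ≤ 1 / 2 + η / 2 := by
      refine le_trans ?_ ((gaussianReal_real_Ioi_mul_sqrt hVpos a).trans_le hgauss)
      rw [← integral_indicator_one measurableSet_Ioi]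
      refine integral_mono (integrable_of_continuous_of_abs_le (by fun_prop) fun z => hf1 _)
        ((integrable_const 1).indicator measurableSet_Ioi) fun z => ?_
      by_cases hz : z ∈ Set.Ioi (-(a * s))
      · rw [Set.indicator_of_mem hz]
        exact Real.smoothTransition.le_one _
      · rw [Set.indicator_of_notMem hz]
        refine (Real.smoothTransition.zero_of_nonpos ?_).le
        rw [Set.mem_Ioi, not_lt] at hz
        have : (0 + z) / b ≤ -1 := by
          rw [div_le_iff₀ hbpos]
          linarith
        linarith
    have herr : ∑ i, L / b ^ 3 * ρ (xs i) ≤ η / 2 := by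
      rw [← Finset.mul_sum]
      have h1 : ∑ i, ρ (xs i) ≤ c * s ^ 2 := by
        rw [hs2, ← hVreal, Finset.mul_sum]
        exact Finset.sum_le_sum fun i _ => hle _
      have h2 : 2 * L * c / (a ^ 3 * η) ≤ s := by
        refine Real.le_sqrt_of_sq_le ?_
        linarith
      rw [div_le_iff₀ (by positivity)] at h2
      calc L / b ^ 3 * ∑ i, ρ (xs i) ≤ L / b ^ 3 * (c * s ^ 2) :=
            mul_le_mul_of_nonneg_left h1 (by positivity)
        _ = L * c / (a ^ 3 * s) := by rw [hb]; field_simp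
        _ ≤ η / 2 := by
          rw [div_le_iff₀ (by positivity)]
          linarith
    linarith [(abs_le.1 hlind).2]

open Classical in
/-- Uniform tail bound for sums of independent variables with nonpositive means. -/
lemma exists_prodExp_tail_le_half_add (hW : IsChannel W) (g : X → Y → ℝ) (m : X → ℝ)
    (hm : ∀ x, 0 ≤ m x) (hmean : ∀ x, ∑ y, W x y * g x y = -m x) {η : ℝ} (hη : 0 < η) :
    ∃ K, 0 < K ∧ ∀ (n : ℕ) (xs : Fin n → X),
      prodExp (fun i => W (xs i)) (fun ys => if K < ∑ i, g (xs i) (ys i) then 1 else 0) ≤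
        1 / 2 + η := by
  obtain ⟨K₁, hK₁, h₁⟩ := exists_prodExp_tail_le_half hW (fun x y => if m x = 0 then g x y else 0)
    (fun x => by
      by_cases hx : m x = 0
      · simp [hx, hmean]
      · simp [hx]) (half_pos hη)
  obtain ⟨K₂, _, h₂⟩ := exists_prodExp_tail_le hW (fun x y => if m x = 0 then 0 else g x y) m hm
    (fun x => by
      by_cases hx : m x = 0
      · simp [hx]
      · simp [hx, hmean])
    (fun x hx => by simp [hx]) (half_pos hη)
  refine ⟨K₁ + K₂, by positivity, fun n xs => ?_⟩
  have hsplit : ∀ ys : Fin n → Y, ∑ i, g (xs i) (ys i) =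
      ∑ i, (if m (xs i) = 0 then g (xs i) (ys i) else 0) +
        ∑ i, (if m (xs i) = 0 then 0 else g (xs i) (ys i)) := by
    intro ys
    rw [← Finset.sum_add_distrib]
    exact Finset.sum_congr rfl fun i _ => by split_ifs <;> simp
  refine (prodExp_mono (fun i => hW _) (G := fun ys =>
    (if K₁ < ∑ i, (if m (xs i) = 0 then g (xs i) (ys i) else 0) then (1 : ℝ) else 0) +
    (if K₂ < ∑ i, (if m (xs i) = 0 then 0 else g (xs i) (ys i)) then (1 : ℝ) else 0))
    fun ys => ?_).trans ?_
  · rw [hsplit ys]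
    split_ifs <;> first | (norm_num; done) | linarith
  · rw [prodExp_add]
    linarith [h₁ K₁ le_rfl n xs, h₂ K₂ le_rfl n xs]

end Tails

/-! ### The converse bound -/

open Classical in
/-- Converse bound on the number of messages in terms of a threshold on likelihood ratios. -/
lemma card_le_of_avgErr_le {A B : Type*} [Fintype B] {V : A → B → ℝ} (hV : ∀ a b, 0 ≤ V a b)
    {Q : B → ℝ} (hQ : IsDist Q) {θ δ ε : ℝ} (hθ : 0 < θ) (hδ : 0 < δ)
    (htail : ∀ a, ∑ b, V a b * (if θ * Q b < V a b then 1 else 0) ≤ 1 - ε - δ)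
    {M : ℕ} (e : Fin M → A) (d : B → Fin M) (herr : avgErr V e d ≤ ε) :
    (M : ℝ) ≤ θ / δ := by
  rcases Nat.eq_zero_or_pos M with rfl | hM
  · simp only [Nat.cast_zero]
    positivity
  have hM' : (0 : ℝ) < M := by exact_mod_cast hM
  have h1 : ∀ m : Fin M, ∑ b ∈ Finset.univ.filter (fun b => d b = m), V (e m) b ≤
      (1 - ε - δ) + θ * ∑ b ∈ Finset.univ.filter (fun b => d b = m), Q b := by
    intro m
    calc ∑ b ∈ Finset.univ.filter (fun b => d b = m), V (e m) b
        ≤ ∑ b ∈ Finset.univ.filter (fun b => d b = m),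
          (V (e m) b * (if θ * Q b < V (e m) b then 1 else 0) + θ * Q b) := by
          refine Finset.sum_le_sum fun b _ => ?_
          have := mul_nonneg hθ.le (hQ.1 b)
          split_ifs <;> linarith
      _ ≤ _ := by
          rw [Finset.sum_add_distrib, ← Finset.mul_sum]
          refine add_le_add_left (le_trans (Finset.sum_le_sum_of_subset_of_nonneg
            (Finset.filter_subset _ _) fun b _ _ => ?_) (htail (e m))) _
          have := hV (e m) b
          split_ifs <;> simp [this]
  have h2 : ∑ m : Fin M, ∑ b ∈ Finset.univ.filter (fun b => d b = m), V (e m) b ≤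
      M * (1 - ε - δ) + θ := by
    refine (Finset.sum_le_sum fun m _ => h1 m).trans ?_
    rw [Finset.sum_add_distrib, ← Finset.mul_sum, Finset.sum_fiberwise, hQ.2, mul_one, Finset.sum_const,
      Finset.card_univ, Fintype.card_fin, nsmul_eq_mul]
  rw [avgErr, sub_le_comm, one_div, inv_mul_eq_div, le_div_iff₀ hM'] at herr
  rw [le_div_iff₀ hδ]
  linarith

open Classical in
/-- The event that a product likelihood ratio exceeds a threshold, in terms of information
densities. -/
lemma sum_prod_mul_ite_le_prodExp {X Y : Type*} [Fintype X] [Fintype Y] {W : X → Y → ℝ}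
    (hW : IsChannel W) {Q : Y → ℝ} (hQ : IsDist Q) (hac : ∀ x y, Q y = 0 → W x y = 0) (C K : ℝ)
    {n : ℕ} (xs : Fin n → X) :
    ∑ ys : Fin n → Y, (∏ i, W (xs i) (ys i)) *
        (if Real.exp (n * C + K) * ∏ i, Q (ys i) < ∏ i, W (xs i) (ys i) then 1 else 0) ≤
      prodExp (fun i => W (xs i)) (fun ys =>
        if K < ∑ i, (Real.log (W (xs i) (ys i) / Q (ys i)) - C) then 1 else 0) := by
  refine prodExp_mono_of_ne_zero (fun i => hW _) (F := fun ys : Fin n → Y =>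
    if Real.exp (n * C + K) * ∏ i, Q (ys i) < ∏ i, W (xs i) (ys i) then 1 else 0)
    fun ys hys => ?_
  have hQ0 : ∀ i, Q (ys i) ≠ 0 := fun i h => hys i (hac _ _ h)
  have hQpos : 0 < ∏ i, Q (ys i) :=
    Finset.prod_pos fun i _ => lt_of_le_of_ne (hQ.1 _) (hQ0 i).symm
  have hWpos : 0 < ∏ i, W (xs i) (ys i) :=
    Finset.prod_pos fun i _ => lt_of_le_of_ne ((hW _).1 _) (hys i).symm
  have hlog : ∑ i, (Real.log (W (xs i) (ys i) / Q (ys i)) - C) =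
      Real.log ((∏ i, W (xs i) (ys i)) / ∏ i, Q (ys i)) - n * C := by
    rw [Finset.sum_sub_distrib, ← Finset.prod_div_distrib,
      Real.log_prod fun i _ => div_ne_zero (hys i) (hQ0 i)]
    simp
  have himp : Real.exp (n * C + K) * ∏ i, Q (ys i) < ∏ i, W (xs i) (ys i) →
      K < ∑ i, (Real.log (W (xs i) (ys i) / Q (ys i)) - C) := by
    intro h
    rw [← lt_div_iff₀ hQpos, ← Real.lt_log_iff_exp_lt (div_pos hWpos hQpos)] at h
    rw [hlog]
    linarith
  split_ifs with h1 h2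
  · exact le_rfl
  · exact absurd (himp h1) h2
  · exact zero_le_one
  · exact le_rfl

open Classical in
/-- A uniform tail bound on the information density yields an upper bound on `Mstar`. -/
lemma log_Mstar_le {X Y : Type*} [Fintype X] [Fintype Y] {W : X → Y → ℝ} (hW : IsChannel W)
    {Q : Y → ℝ} (hQ : IsDist Q) (hac : ∀ x y, Q y = 0 → W x y = 0) {C K δ ε : ℝ} (hC : 0 ≤ C)
    (hK : 0 ≤ K) (hδ : 0 < δ) (n : ℕ)
    (htail : ∀ xs : Fin n → X, prodExp (fun i => W (xs i)) (fun ys =>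
      if K < ∑ i, (Real.log (W (xs i) (ys i) / Q (ys i)) - C) then 1 else 0) ≤ 1 - ε - δ) :
    Real.log (Mstar (fun (xs : Fin n → X) (ys : Fin n → Y) => ∏ i, W (xs i) (ys i)) ε) ≤
      n * C + (K + |Real.log δ|) := by
  have hB : 0 ≤ Real.exp (n * C + K) / δ := by positivity
  have hle : (Mstar (fun (xs : Fin n → X) (ys : Fin n → Y) => ∏ i, W (xs i) (ys i)) ε : ℝ) ≤
      Real.exp (n * C + K) / δ := by
    refine (Nat.le_floor_iff hB).1 (csSup_le' ?_)
    rintro M ⟨e, d, herr⟩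
    refine Nat.le_floor (card_le_of_avgErr_le (Q := fun ys => ∏ i, Q (ys i))
      (fun xs ys => Finset.prod_nonneg fun i _ => (hW _).1 _)
      ⟨fun ys => Finset.prod_nonneg fun i _ => hQ.1 _, sum_prod_eq_one fun _ => hQ⟩
      (Real.exp_pos _) hδ (fun xs => ?_) e d herr)
    exact (sum_prod_mul_ite_le_prodExp hW hQ hac C K xs).trans (htail xs)
  rcases Nat.eq_zero_or_pos
    (Mstar (fun (xs : Fin n → X) (ys : Fin n → Y) => ∏ i, W (xs i) (ys i)) ε) with h0 | h0
  · rw [h0, Nat.cast_zero, Real.log_zero]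
    positivity
  · refine (Real.log_le_log (by exact_mod_cast h0) hle).trans ?_
    rw [Real.log_div (Real.exp_pos _).ne' hδ.ne', Real.log_exp]
    linarith [neg_abs_le (Real.log δ)]

/-- For a DMC `W` and `ε ∈ (0,1)` with `V_ε = 0`, provided it is not the
case that `W` is exotic and `ε ≥ 1/2`, we have `log M*(Wⁿ, ε) ≤ n C + K` for a constant `K`. -/
theorem converse_zero_dispersion
    {X Y : Type*} [Fintype X] [Fintype Y] [Nonempty X] [Nonempty Y]
    (W : X → Y → ℝ) (hW : IsChannel W) (ε : ℝ) (hε : ε ∈ Set.Ioo (0 : ℝ) 1)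
    (hV : Veps W ε = 0) (hne : ¬ (IsExotic W ∧ 1/2 ≤ ε)) :
    ∃ K : ℝ, ∀ n : ℕ, 1 ≤ n →
      Real.log (Mstar (fun (xs : Fin n → X) (ys : Fin n → Y) => ∏ i, W (xs i) (ys i)) ε) ≤
        (n : ℝ) * capacity W + K := by
  classical
  obtain ⟨P, hP⟩ := exists_isCAID hW
  set Q := outDist P W with hQdef
  have hQ : IsDist Q := isDist_outDist hW hP.1
  have hac : ∀ x y, Q y = 0 → W x y = 0 := fun x y => eq_zero_of_outDist_eq_zero hW hP x
  set g : X → Y → ℝ := fun x y => Real.log (W x y / Q y) - capacity W with hg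
  set m : X → ℝ := fun x => capacity W - relEnt (W x) Q with hmdef
  have hm : ∀ x, 0 ≤ m x := fun x => sub_nonneg.2 (relEnt_le_capacity hW hP x)
  have hmean : ∀ x, ∑ y, W x y * g x y = -m x := by
    intro x
    simp only [hg, hmdef, mul_sub, Finset.sum_sub_distrib, ← Finset.sum_mul, (hW x).2, relEnt]
    ring
  have hvar : ∀ x, ∑ y, W x y * (g x y + m x) ^ 2 = divVar (W x) Q := by
    intro x
    refine Finset.sum_congr rfl fun y _ => ?_
    simp only [hg, hmdef]
    ring
  obtain ⟨K, δ, hK, hδ, htail⟩ : ∃ K δ : ℝ, 0 < K ∧ 0 < δ ∧ ∀ (n : ℕ) (xs : Fin n → X),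
      prodExp (fun i => W (xs i)) (fun ys => if K < ∑ i, g (xs i) (ys i) then 1 else 0) ≤
        1 - ε - δ := by
    rcases lt_or_ge ε (1 / 2) with hlt | hge
    · have hη : 0 < (1 / 2 - ε) / 2 := by linarith
      obtain ⟨K, hK, h⟩ := exists_prodExp_tail_le_half_add hW g m hm hmean hη
      exact ⟨K, (1 / 2 - ε) / 2, hK, hη, fun n xs => (h n xs).trans (by linarith)⟩
    · have hη : 0 < (1 - ε) / 2 := by linarith [hε.2]
      have hVmax : Vmax W = 0 := by rwa [Veps, if_neg (not_lt.2 hge)] at hV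
      have hzero : ∀ x, m x = 0 → ∑ y, W x y * (g x y + m x) ^ 2 = 0 := by
        intro x hx
        rw [hvar x]
        by_contra hne0
        have hnn : 0 ≤ divVar (W x) Q :=
          Finset.sum_nonneg fun y _ => mul_nonneg ((hW x).1 y) (sq_nonneg _)
        refine hne ⟨⟨hVmax, x, fun P' hP' => ?_⟩, hge⟩
        rw [outDist_eq_of_isCAID hW hP hP']
        exact ⟨(sub_eq_zero.1 hx).symm, lt_of_le_of_ne hnn (Ne.symm hne0)⟩
      obtain ⟨K, hK, h⟩ := exists_prodExp_tail_le hW g m hm hmean hzero hη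
      exact ⟨K, (1 - ε) / 2, hK, hη, fun n xs => (h K le_rfl n xs).trans (by linarith)⟩
  exact ⟨K + |Real.log δ|, fun n _ =>
    log_Mstar_le hW hQ hac (capacity_nonneg hW) hK.le hδ n (htail n)⟩
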